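/- In a global graph with r communities of n vertices each, n ≥ r ≥ 2, with each community inducing a complete graph, if the graph has diameter at most 3 and some pair of communities is not joined by any bridge, then the number of bridges is at least n + (r−1)(r−2)/2; hence the minimum number of bridges over all diameter-3 global graphs is r(r−1)/2. -/

import Mathlib

open SimpleGraph

variable {r n : ℕ}

/-- Each community (fiber of `Prod.fst`) induces a complete graph. -/
def IntraComplete (G : SimpleGraph (Fin r × Fin n)) : Prop :=
  ∀ u v : Fin r × Fin n, u ≠ v → u.1 = v.1 → G.Adj u v

/-- Number of bridges: edges whose endpoints lie in distinct communities. -/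
noncomputable def bridgeCount (G : SimpleGraph (Fin r × Fin n)) : ℕ :=
  {e ∈ G.edgeSet | ¬ (Sym2.map Prod.fst e).IsDiag}.ncard

/-- A vertex is central if it is an endpoint of a bridge. -/
def IsCentral (G : SimpleGraph (Fin r × Fin n)) (v : Fin r × Fin n) : Prop :=
  ∃ w, G.Adj v w ∧ v.1 ≠ w.1

/-- Number of central vertices. -/
noncomputable def centralCount (G : SimpleGraph (Fin r × Fin n)) : ℕ :=
  {v | IsCentral G v}.ncard

/-- Every two vertices are joined by a path (walk) of length at most `k`. -/
def DiamLe (G : SimpleGraph (Fin r × Fin n)) (k : ℕ) : Prop :=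
  ∀ u v : Fin r × Fin n, ∃ p : G.Walk u v, p.length ≤ k

open Classical in
/-- The number of ordered pairs of vertices joined by a bridge is twice the number of bridges. -/
lemma two_mul_bridgeCount (G : SimpleGraph (Fin r × Fin n)) :
    2 * bridgeCount G = ∑ u, ∑ v, if G.Adj u v ∧ u.1 ≠ v.1 then 1 else 0 := by
  let H : SimpleGraph (Fin r × Fin n) :=
    { Adj := fun u v => G.Adj u v ∧ u.1 ≠ v.1
      symm := ⟨fun u v h => ⟨h.1.symm, h.2.symm⟩⟩
      loopless := ⟨fun u h => h.2 rfl⟩ }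
  have hset : {e ∈ G.edgeSet | ¬ (Sym2.map Prod.fst e).IsDiag} = (H.edgeFinset : Set _) := by
    ext e
    induction e with
    | _ u v => simp [H]
  rw [bridgeCount, hset, Set.ncard_coe_finset, ← H.sum_degrees_eq_twice_card_edges]
  refine Finset.sum_congr rfl fun u _ => ?_
  rw [← H.card_neighborFinset_eq_degree, H.neighborFinset_eq_filter, Finset.card_filter]

/-- Weights on ordered pairs whose two orientations always add up to `2` do not change the total
over a symmetric relation. -/
lemma sum_weight_eq {V : Type*} [Fintype V] (h c : V → V → ℕ) (hsymm : ∀ u v, h u v = h v u)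
    (hc : ∀ u v, c u v + c v u = 2) :
    ∑ u, ∑ v, h u v * c u v = ∑ u, ∑ v, h u v := by
  have key : ∑ u, ∑ v, h u v * c u v + ∑ u, ∑ v, h u v * c v u = 2 * ∑ u, ∑ v, h u v := by
    simp only [← Finset.sum_add_distrib, ← mul_add, hc, ← Finset.sum_mul]
    ring
  have hswap : ∑ u, ∑ v, h u v * c v u = ∑ u, ∑ v, h u v * c u v := by
    rw [Finset.sum_comm]
    exact Finset.sum_congr rfl fun u _ => Finset.sum_congr rfl fun v _ => by rw [hsymm]
  omega

/-- If community `j` has a vertex `b` that is not central and no bridge joins `a`'s community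
to `j`, then `a` has a bridge to a vertex having itself a bridge to `j`. -/
lemma exists_bridge_bridge {G : SimpleGraph (Fin r × Fin n)} (hd : DiamLe G 3)
    {a b : Fin r × Fin n} (hab : a.1 ≠ b.1) (hb : ¬ IsCentral G b)
    (hno : ∀ x y : Fin r × Fin n, x.1 = a.1 → y.1 = b.1 → ¬ G.Adj x y) :
    ∃ d e : Fin r × Fin n, G.Adj a d ∧ a.1 ≠ d.1 ∧ G.Adj d e ∧ d.1 ≠ e.1 ∧ e.1 = b.1 := by
  have hlast : ∀ y, G.Adj y b → y.1 = b.1 := fun y hy => by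
    by_contra h
    exact hb ⟨y, hy.symm, fun h' => h h'.symm⟩
  obtain ⟨p, hp⟩ := hd a b
  match p, hp with
  | .nil, _ => exact absurd rfl hab
  | .cons h .nil, _ => exact absurd h (hno _ _ rfl rfl)
  | .cons h (.cons h' .nil), _ => exact absurd h (hno _ _ rfl (hlast _ h'))
  | .cons (v := x) h (.cons (v := y) h' (.cons h'' .nil)), _ =>
    have hy := hlast _ h''
    have hxa : a.1 ≠ x.1 := fun e => hno _ _ e.symm hy h'
    exact ⟨x, y, h, hxa, h', fun e => hno _ _ rfl (e.trans hy) h, hy⟩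
  | .cons _ (.cons _ (.cons _ (.cons _ q))), hp =>
    simp only [Walk.length_cons] at hp
    omega

/-- Communities `i` and `j` are joined by a bridge. -/
def CommunitiesJoined (G : SimpleGraph (Fin r × Fin n)) (i j : Fin r) : Prop :=
  ∃ a b : Fin n, G.Adj (i, a) (j, b)

open Classical in
/-- A graph all of whose pairs of communities are joined has at least `r.choose 2` bridges. -/
lemma le_two_mul_bridgeCount_of_joined {G : SimpleGraph (Fin r × Fin n)}
    (h : ∀ i j, i ≠ j → CommunitiesJoined G i j) : r * (r - 1) ≤ 2 * bridgeCount G := by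
  rw [two_mul_bridgeCount, Fintype.sum_prod_type]
  have hrow : ∀ i : Fin r, r - 1 ≤
      ∑ a : Fin n, ∑ v : Fin r × Fin n, if G.Adj (i, a) v ∧ i ≠ v.1 then 1 else 0 := by
    intro i
    simp only [Fintype.sum_prod_type]
    rw [Finset.sum_comm]
    calc r - 1 = ∑ j ∈ Finset.univ.erase i, 1 := by simp
      _ ≤ ∑ j ∈ Finset.univ.erase i, ∑ a : Fin n, ∑ b : Fin n,
            if G.Adj (i, a) (j, b) ∧ i ≠ j then 1 else 0 := by
          refine Finset.sum_le_sum fun j hj => ?_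
          have hij : i ≠ j := (Finset.ne_of_mem_erase hj).symm
          obtain ⟨a, b, hab⟩ := h i j hij
          refine le_trans ?_ (Finset.single_le_sum (fun _ _ => Nat.zero_le _) (Finset.mem_univ a))
          refine le_trans ?_ (Finset.single_le_sum (fun _ _ => Nat.zero_le _) (Finset.mem_univ b))
          simp [hab, hij]
      _ ≤ _ := Finset.sum_le_sum_of_subset (Finset.subset_univ _)
  calc r * (r - 1) = ∑ _i : Fin r, (r - 1) := by simp
    _ ≤ _ := Finset.sum_le_sum fun i _ => hrow i

/-- A community is full if all of its vertices are central. -/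
def Full (G : SimpleGraph (Fin r × Fin n)) (i : Fin r) : Prop :=
  ∀ a : Fin n, IsCentral G (i, a)

/-- The vertex has a bridge to a community that is not full. -/
def TouchesNonfull (G : SimpleGraph (Fin r × Fin n)) (v : Fin r × Fin n) : Prop :=
  ∃ w, G.Adj v w ∧ v.1 ≠ w.1 ∧ ¬ Full G w.1

open Classical in
/-- Discharging weights: a bridge is charged to its full end if only one end is full, and among
full communities a vertex touching a nonfull community passes its charge to its neighbours. -/
noncomputable def charge (G : SimpleGraph (Fin r × Fin n)) (v w : Fin r × Fin n) : ℕ :=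
  if Full G v.1 then
    if Full G w.1 then
      (if TouchesNonfull G v then 0 else 1) + (if TouchesNonfull G w then 1 else 0)
    else 2
  else if Full G w.1 then 0 else 1

lemma charge_add_charge (G : SimpleGraph (Fin r × Fin n)) (v w : Fin r × Fin n) :
    charge G v w + charge G w v = 2 := by
  unfold charge
  split_ifs <;> rfl

lemma joined_of_not_full {G : SimpleGraph (Fin r × Fin n)} (hd : DiamLe G 3) {i j : Fin r}
    (hij : i ≠ j) (hi : ¬ Full G i) (hj : ¬ Full G j) : CommunitiesJoined G i j := by
  by_contra hno
  obtain ⟨b, hb⟩ := not_forall.1 hj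
  refine hi fun a => ?_
  obtain ⟨d, e, had, hne, -⟩ := exists_bridge_bridge hd (a := (i, a)) (b := (j, b)) hij hb
    (by rintro ⟨x, x'⟩ ⟨y, y'⟩ rfl rfl h; exact hno ⟨_, _, h⟩)
  exact ⟨d, had, hne⟩

open Classical in
/-- The total weight of the bridges at a vertex. -/
noncomputable def load (G : SimpleGraph (Fin r × Fin n)) (v : Fin r × Fin n) : ℕ :=
  ∑ w, (if G.Adj v w ∧ v.1 ≠ w.1 then 1 else 0) * charge G v w

lemma sum_load (G : SimpleGraph (Fin r × Fin n)) :
    ∑ i : Fin r, ∑ a : Fin n, load G (i, a) = 2 * bridgeCount G := by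
  classical
  rw [← Fintype.sum_prod_type (f := load G), two_mul_bridgeCount]
  refine sum_weight_eq _ (charge G) (fun u v => ?_) (charge_add_charge G)
  simp only [G.adj_comm u v, ne_comm (a := u.1)]

lemma charge_le_load {G : SimpleGraph (Fin r × Fin n)} {v w : Fin r × Fin n} (h : G.Adj v w)
    (hne : v.1 ≠ w.1) : charge G v w ≤ load G v := by
  classical
  refine le_trans ?_ (Finset.single_le_sum (fun _ _ => Nat.zero_le _) (Finset.mem_univ w))
  simp [h, hne]

/-- A vertex with a bridge to a nonfull community, or to a vertex having such a bridge,
has load at least `2`. -/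
lemma two_le_load {G : SimpleGraph (Fin r × Fin n)} {v w : Fin r × Fin n} (hv : Full G v.1)
    (h : G.Adj v w) (hne : v.1 ≠ w.1) (hw : ¬ Full G w.1 ∨ TouchesNonfull G w) :
    2 ≤ load G v := by
  have touch : TouchesNonfull G v → 2 ≤ load G v := by
    rintro ⟨x, hx, hx', hx''⟩
    simpa [charge, hv, hx''] using charge_le_load hx hx'
  by_cases hF : Full G w.1
  · by_cases ht : TouchesNonfull G v
    · exact touch ht
    · simpa [charge, hv, hF, ht, hw.resolve_left (not_not.2 hF)] using charge_le_load h hne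
  · exact touch ⟨w, h, hne, hF⟩

open Classical in
/-- The load of a central vertex in a full community exceeds the number of its bridges to nonfull
communities. -/
lemma succ_le_load {G : SimpleGraph (Fin r × Fin n)} {v : Fin r × Fin n} (hv : Full G v.1) :
    1 + ∑ j with ¬ Full G j, ∑ b : Fin n,
      (if G.Adj v (j, b) ∧ v.1 ≠ j then 1 else 0) ≤ load G v := by
  by_cases ht : TouchesNonfull G v
  · set s := ∑ j with ¬ Full G j, ∑ b : Fin n, (if G.Adj v (j, b) ∧ v.1 ≠ j then 1 else 0)
      with hs
    have hpos : 1 ≤ s := by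
      obtain ⟨⟨j, b⟩, h, hne, hF⟩ := ht
      refine le_trans ?_ (Finset.single_le_sum (fun _ _ => Nat.zero_le _)
        (Finset.mem_filter.2 ⟨Finset.mem_univ j, hF⟩))
      refine le_trans ?_ (Finset.single_le_sum (fun _ _ => Nat.zero_le _) (Finset.mem_univ b))
      simp_all
    have hle : s * 2 ≤ load G v := by
      rw [load, Fintype.sum_prod_type, hs, Finset.sum_mul]
      refine le_trans (Finset.sum_le_sum fun j hj => ?_)
        (Finset.sum_le_sum_of_subset (Finset.filter_subset (fun j => ¬ Full G j) Finset.univ))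
      rw [Finset.sum_mul]
      refine Finset.sum_le_sum fun b _ => le_of_eq ?_
      simp [charge, hv, (Finset.mem_filter.1 hj).2]
    omega
  · have hzero : ∑ j with ¬ Full G j, ∑ b : Fin n,
        (if G.Adj v (j, b) ∧ v.1 ≠ j then 1 else 0) = 0 := by
      refine Finset.sum_eq_zero fun j hj => Finset.sum_eq_zero fun b _ => if_neg fun h => ?_
      exact ht ⟨(j, b), h.1, h.2, (Finset.mem_filter.1 hj).2⟩
    rw [hzero]
    obtain ⟨w, hw, hne⟩ := hv v.2
    have hF : Full G w.1 := by
      by_contra hF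
      exact ht ⟨w, hw, hne, hF⟩
    refine le_trans ?_ (charge_le_load hw hne)
    simp [charge, hv, hF, ht]

open Classical in
lemma sum_load_of_not_full {G : SimpleGraph (Fin r × Fin n)} (hd : DiamLe G 3) {i : Fin r}
    (hi : ¬ Full G i) :
    (Finset.univ.filter fun j => ¬ Full G j).card - 1 ≤ ∑ a : Fin n, load G (i, a) := by
  simp only [load, Fintype.sum_prod_type]
  rw [Finset.sum_comm]
  rw [← Finset.card_erase_of_mem (Finset.mem_filter.2 ⟨Finset.mem_univ i, hi⟩),
    Finset.card_eq_sum_ones]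
  refine le_trans (Finset.sum_le_sum fun j hj => ?_) (Finset.sum_le_sum_of_subset
    (Finset.subset_univ ((Finset.univ.filter fun j => ¬ Full G j).erase i)))
  obtain ⟨hji, hj⟩ := Finset.mem_erase.1 hj
  have hj := (Finset.mem_filter.1 hj).2
  obtain ⟨a, b, hab⟩ := joined_of_not_full hd (Ne.symm hji) hi hj
  refine le_trans ?_ (Finset.single_le_sum (fun _ _ => Nat.zero_le _) (Finset.mem_univ a))
  refine le_trans ?_ (Finset.single_le_sum (fun _ _ => Nat.zero_le _) (Finset.mem_univ b))
  simp [hab, Ne.symm hji, charge, hi, hj]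

open Classical in
lemma sum_load_of_full (hn : r ≤ n) {G : SimpleGraph (Fin r × Fin n)} (hd : DiamLe G 3)
    {i : Fin r} (hi : Full G i) :
    n + (Finset.univ.filter fun j => ¬ Full G j).card ≤ ∑ a : Fin n, load G (i, a) := by
  by_cases hJ : ∀ j, ¬ Full G j → CommunitiesJoined G i j
  · refine le_trans ?_ (Finset.sum_le_sum fun a _ => succ_le_load (v := (i, a)) hi)
    rw [Finset.sum_add_distrib, Finset.sum_comm, Finset.card_eq_sum_ones]
    refine add_le_add (by simp) (Finset.sum_le_sum fun j hj => ?_)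
    have hj := (Finset.mem_filter.1 hj).2
    have hij : i ≠ j := by rintro rfl; exact hj hi
    obtain ⟨a, b, hab⟩ := hJ j hj
    refine le_trans ?_ (Finset.single_le_sum (fun _ _ => Nat.zero_le _) (Finset.mem_univ a))
    refine le_trans ?_ (Finset.single_le_sum (fun _ _ => Nat.zero_le _) (Finset.mem_univ b))
    simp [hab, hij]
  · push Not at hJ
    obtain ⟨j, hj, hno⟩ := hJ
    obtain ⟨b, hb⟩ := not_forall.1 hj
    have hij : i ≠ j := by rintro rfl; exact hj hi
    have hcard : (Finset.univ.filter fun j => ¬ Full G j).card ≤ n :=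
      (Finset.card_le_univ _).trans (by simpa using hn)
    calc _ ≤ ∑ _a : Fin n, 2 := by simp; omega
      _ ≤ _ := Finset.sum_le_sum fun a _ => by
        obtain ⟨d, e, had, hne, hde, hde', he⟩ :=
          exists_bridge_bridge hd (a := (i, a)) (b := (j, b)) hij hb
            (by rintro ⟨x, x'⟩ ⟨y, y'⟩ rfl rfl h; exact hno ⟨_, _, h⟩)
        exact two_le_load hi had hne (.inr ⟨e, hde, hde', by rwa [he]⟩)

/-- A diameter-three graph with an unjoined pair of communities has at least
`n + (r - 1).choose 2` bridges. -/
lemma le_two_mul_bridgeCount_of_not_joined (hn : r ≤ n) {G : SimpleGraph (Fin r × Fin n)}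
    (hd : DiamLe G 3) {i j : Fin r} (hij : i ≠ j) (hno : ¬ CommunitiesJoined G i j) :
    2 * n + (r - 1) * (r - 2) ≤ 2 * bridgeCount G := by
  classical
  obtain ⟨k, hk⟩ : ∃ k, Full G k := by
    by_contra! h
    exact hno (joined_of_not_full hd hij (h i) (h j))
  rw [← sum_load, ← Finset.sum_filter_add_sum_filter_not Finset.univ (Full G)]
  set N := Finset.univ.filter fun j => ¬ Full G j with hN
  set F := Finset.univ.filter fun j => Full G j with hF
  have hcard : F.card + N.card = r := by
    simpa using Finset.card_filter_add_card_filter_not (s := Finset.univ) (Full G)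
  have hkF : k ∈ F := by simp [hF, hk]
  have hNsum : N.card * (N.card - 1) ≤ ∑ i ∈ N, ∑ a : Fin n, load G (i, a) := by
    rw [← smul_eq_mul]
    exact Finset.card_nsmul_le_sum _ _ _ fun i hi =>
      sum_load_of_not_full hd (Finset.mem_filter.1 hi).2
  have hpos : 1 ≤ F.card := Finset.card_pos.2 ⟨k, hkF⟩
  rcases hpos.eq_or_lt with h1 | h2
  · obtain ⟨k', hk'⟩ := Finset.card_eq_one.1 h1.symm
    obtain rfl : k = k' := by simpa [hk'] using hkF
    have hload : 2 * n ≤ ∑ a : Fin n, load G (k, a) := by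
      calc 2 * n = ∑ _a : Fin n, 2 := by simp [mul_comm]
        _ ≤ _ := Finset.sum_le_sum fun a _ => by
          obtain ⟨w, hw, hne⟩ := hk a
          refine two_le_load hk hw hne (.inl fun hwF => hne ?_)
          have : w.1 ∈ F := by simp [hF, hwF]
          rw [hk'] at this
          exact (Finset.mem_singleton.1 this).symm
    rw [hk', Finset.sum_singleton]
    have hr : N.card = r - 1 := by omega
    rw [hr, Nat.sub_sub, one_add_one_eq_two] at hNsum
    omega
  · have hFsum : F.card * (n + N.card) ≤ ∑ i ∈ F, ∑ a : Fin n, load G (i, a) := by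
      rw [← smul_eq_mul]
      exact Finset.card_nsmul_le_sum _ _ _ fun i hi =>
        sum_load_of_full hn hd (Finset.mem_filter.1 hi).2
    refine le_trans ?_ (add_le_add hFsum hNsum)
    generalize F.card = f at *
    generalize N.card = m at *
    subst hcard
    obtain ⟨f, rfl⟩ := Nat.exists_eq_add_of_le h2
    obtain ⟨t, rfl⟩ := Nat.exists_eq_add_of_le hn
    have h3 : Nat.succ 1 + f + m - 1 = f + m + 1 := by omega
    have h4 : Nat.succ 1 + f + m - 2 = f + m := by omega
    rw [h3, h4]
    rcases m with _ | m
    · simp; nlinarith [Nat.zero_le (f * t)]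
    · simp; nlinarith [Nat.zero_le (f * t)]

/-- The graph in which the vertices `(i, c)` form a complete graph across communities. -/
def hubGraph (r : ℕ) (c : Fin n) : SimpleGraph (Fin r × Fin n) where
  Adj u v := u ≠ v ∧ (u.1 = v.1 ∨ (u.2 = c ∧ v.2 = c))
  symm := ⟨fun _ _ h => ⟨h.1.symm, h.2.imp Eq.symm And.symm⟩⟩
  loopless := ⟨fun _ h => h.1 rfl⟩

lemma hubGraph_diamLe (c : Fin n) : DiamLe (hubGraph r c) 3 := by
  have step : ∀ u v, (u.1 = v.1 ∨ (u.2 = c ∧ v.2 = c)) →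
      ∃ p : (hubGraph r c).Walk u v, p.length ≤ 1 := fun u v h => by
    by_cases e : u = v
    · subst e
      exact ⟨.nil, by simp⟩
    · have hadj : (hubGraph r c).Adj u v := ⟨e, h⟩
      exact ⟨hadj.toWalk, by simp⟩
  intro u v
  obtain ⟨p, hp⟩ := step u (u.1, c) (.inl rfl)
  obtain ⟨q, hq⟩ := step (u.1, c) (v.1, c) (.inr ⟨rfl, rfl⟩)
  obtain ⟨s, hs⟩ := step (v.1, c) v (.inl rfl)
  exact ⟨(p.append q).append s, by simp only [Walk.length_append]; omega⟩

lemma two_mul_bridgeCount_hubGraph (c : Fin n) :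
    2 * bridgeCount (hubGraph r c) = r * (r - 1) := by
  classical
  rw [two_mul_bridgeCount]
  have hadj : ∀ (i j : Fin r) (a b : Fin n), ((hubGraph r c).Adj (i, a) (j, b) ∧ i ≠ j) ↔
      (a = c ∧ b = c ∧ i ≠ j) := by
    intro i j a b
    simp only [hubGraph, ne_eq, Prod.mk.injEq]
    tauto
  simp only [Fintype.sum_prod_type, hadj, ite_and, Finset.sum_ite_irrel, Finset.sum_ite_eq',
    Finset.mem_univ, if_true, Finset.sum_const_zero]
  have hrow : ∀ i : Fin r, (∑ j : Fin r, if i ≠ j then 1 else 0) = r - 1 := fun i => by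
    rw [← Finset.card_filter, Finset.filter_ne, Finset.card_erase_of_mem (Finset.mem_univ i),
      Finset.card_univ, Fintype.card_fin]
  simp only [hrow, Finset.sum_const, Finset.card_univ, Fintype.card_fin, smul_eq_mul]

theorem stmt_6 (r n : ℕ) (hr : 2 ≤ r) (hn : r ≤ n) :
    (∀ G : SimpleGraph (Fin r × Fin n), IntraComplete G → DiamLe G 3 →
      (∃ i j : Fin r, i ≠ j ∧
        ∀ a b : Fin r × Fin n, a.1 = i → b.1 = j → ¬ G.Adj a b) →
      n + (r - 1) * (r - 2) / 2 ≤ bridgeCount G) ∧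
    IsLeast {m | ∃ G : SimpleGraph (Fin r × Fin n),
        IntraComplete G ∧ DiamLe G 3 ∧ bridgeCount G = m} (r * (r - 1) / 2) := by
  have first : ∀ G : SimpleGraph (Fin r × Fin n), DiamLe G 3 →
      (∃ i j : Fin r, i ≠ j ∧
        ∀ a b : Fin r × Fin n, a.1 = i → b.1 = j → ¬ G.Adj a b) →
      n + (r - 1) * (r - 2) / 2 ≤ bridgeCount G := by
    rintro G hd ⟨i, j, hij, hno⟩
    have := le_two_mul_bridgeCount_of_not_joined hn hd hij
      (by rintro ⟨a, b, h⟩; exact hno _ _ rfl rfl h)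
    omega
  refine ⟨fun G _ => first G, ?_, ?_⟩
  · let c : Fin n := ⟨0, by omega⟩
    refine ⟨hubGraph r c, fun u v h e => ⟨h, .inl e⟩, hubGraph_diamLe c, ?_⟩
    have := two_mul_bridgeCount_hubGraph (r := r) c
    omega
  · rintro _ ⟨G, -, hd, rfl⟩
    by_cases hJ : ∀ i j, i ≠ j → CommunitiesJoined G i j
    · have := le_two_mul_bridgeCount_of_joined hJ
      omega
    · push Not at hJ
      obtain ⟨i, j, hij, hno⟩ := hJ
      have := le_two_mul_bridgeCount_of_not_joined hn hd hij hno
      obtain ⟨s, rfl⟩ := Nat.exists_eq_add_of_le hr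
      have h1 : 2 + s - 1 = s + 1 := by omega
      have h2 : 2 + s - 2 = s := by omega
      rw [h1, h2] at this
      rw [h1]
      have : (2 + s) * (s + 1) ≤ 2 * bridgeCount G := by nlinarith
      omega
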